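/- Let A be a formal variable, and work in the field ℚ(A) of rational functions, with {k} = (-A)^k - (-A)^{-k} and {n}! = {1}{2}···{n}, {0}! = 1. For all m, n ≥ 0 and 0 ≤ l ≤ min(m,n), the element C^l_{m,n} = (-1)^l {m}!{n}!{m+n+1}! / ({m-l}!{n-l}!{m+n+1-l}!{l}!) of ℚ(A) is a Laurent polynomial in A with integer coefficients, i.e., it lies in the subring ℤ[A, A^{-1}] ⊂ ℚ(A). -/

import Mathlib

open Finset

/-- Quantum integer `{k} = (-A)^k - (-A)^(-k)`. -/
noncomputable def qint {F : Type*} [Field F] (A : F) (k : ℤ) : F :=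
  (-A) ^ k - (-A) ^ (-k)

/-- Quantum factorial `{n}! = {1}{2}⋯{n}`, with `{0}! = 1`. -/
noncomputable def qfact {F : Type*} [Field F] (A : F) (n : ℕ) : F :=
  ∏ k ∈ Finset.range n, qint A ((k : ℤ) + 1)

/-- `C^l_{m,n} = (-1)^l {m}!{n}!{m+n+1}! / ({m-l}!{n-l}!{m+n+1-l}!{l}!)`. -/
noncomputable def Ccoef {F : Type*} [Field F] (A : F) (l m n : ℕ) : F :=
  (-1) ^ l * (qfact A m * qfact A n * qfact A (m + n + 1)) /
    (qfact A (m - l) * qfact A (n - l) * qfact A (m + n + 1 - l) * qfact A l)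

/-- The subring `ℤ[A, A⁻¹]` of the rational function field `ℚ(A)`,
where `A` is the formal variable. -/
noncomputable def LaurentZ : Subring (RatFunc ℚ) :=
  Subring.closure {RatFunc.X, (RatFunc.X)⁻¹}

section QuantumFactorial

variable {F : Type*} [Field F] {A : F}

theorem qfact_zero : qfact A 0 = 1 := by simp [qfact]

theorem qfact_succ (n : ℕ) : qfact A (n + 1) = qfact A n * qint A ((n : ℤ) + 1) :=
  Finset.prod_range_succ _ _

theorem qint_add (hA : A ≠ 0) (a b : ℤ) :
    qint A (a + b) = (-A) ^ b * qint A a + (-A) ^ (-a) * qint A b := by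
  have h : -A ≠ 0 := neg_ne_zero.mpr hA
  simp only [qint, mul_sub, ← zpow_add₀ h]
  rw [add_comm a b, neg_add_rev, add_comm (-a) b]
  ring

theorem qfact_ne_zero (h : ∀ k : ℕ, qint A ((k : ℤ) + 1) ≠ 0) (n : ℕ) : qfact A n ≠ 0 :=
  Finset.prod_ne_zero_iff.mpr fun k _ => h k

variable {S : Subring F}

theorem neg_zpow_mem (hA : A ∈ S) (hA' : A⁻¹ ∈ S) (k : ℤ) : (-A) ^ k ∈ S := by
  cases k with
  | ofNat k => simpa using pow_mem (neg_mem hA) k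
  | negSucc k =>
    rw [zpow_negSucc, ← inv_pow, inv_neg]
    exact pow_mem (neg_mem hA') _

theorem qfact_mem (hA : A ∈ S) (hA' : A⁻¹ ∈ S) (n : ℕ) : qfact A n ∈ S :=
  prod_mem fun _ _ => sub_mem (neg_zpow_mem hA hA' _) (neg_zpow_mem hA hA' _)

/-- Quantum binomial coefficients are integral, by the quantum Pascal rule. -/
theorem qfact_add_div_mem (hA : A ∈ S) (hA' : A⁻¹ ∈ S) (h0 : A ≠ 0)
    (h : ∀ k : ℕ, qint A ((k : ℤ) + 1) ≠ 0) (a b : ℕ) :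
    qfact A (a + b) / (qfact A a * qfact A b) ∈ S := by
  induction a generalizing b with
  | zero => simp [qfact_zero, div_self (qfact_ne_zero h b)]
  | succ a iha =>
    induction b with
    | zero => simp [qfact_zero, div_self (qfact_ne_zero h (a + 1))]
    | succ b ihb =>
      have key : qfact A (a + 1 + (b + 1)) / (qfact A (a + 1) * qfact A (b + 1)) =
          (-A) ^ ((b : ℤ) + 1) * (qfact A (a + (b + 1)) / (qfact A a * qfact A (b + 1))) +
          (-A) ^ (-((a : ℤ) + 1)) *
            (qfact A (a + 1 + b) / (qfact A (a + 1) * qfact A b)) := by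
        have e : a + 1 + b = a + (b + 1) := by ring
        have hq : qfact A (a + 1 + (b + 1)) = qfact A (a + (b + 1)) *
            ((-A) ^ ((b : ℤ) + 1) * qint A ((a : ℤ) + 1) +
              (-A) ^ (-((a : ℤ) + 1)) * qint A ((b : ℤ) + 1)) := by
          rw [← qint_add h0, ← add_assoc, qfact_succ, e]
          congr 2
          push_cast
          ring
        rw [hq, e, qfact_succ a, qfact_succ b]
        have ha := qfact_ne_zero h a
        have hb := qfact_ne_zero h b
        have ha' := h a
        have hb' := h b
        generalize (-A) ^ ((b : ℤ) + 1) = u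
        generalize (-A) ^ (-((a : ℤ) + 1)) = v
        field_simp
      rw [key]
      exact add_mem (mul_mem (neg_zpow_mem hA hA' _) (iha _))
        (mul_mem (neg_zpow_mem hA hA' _) ihb)

theorem Ccoef_mem (hA : A ∈ S) (hA' : A⁻¹ ∈ S) (h0 : A ≠ 0)
    (h : ∀ k : ℕ, qint A ((k : ℤ) + 1) ≠ 0) {l m n : ℕ} (hm : l ≤ m) (hn : l ≤ n) :
    Ccoef A l m n ∈ S := by
  have binom {N : ℕ} (hN : l ≤ N) : qfact A N / (qfact A (N - l) * qfact A l) ∈ S := by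
    simpa [Nat.sub_add_cancel hN] using qfact_add_div_mem hA hA' h0 h (N - l) l
  have hN : l ≤ m + n + 1 := by omega
  have key : Ccoef A l m n = (-1) ^ l * (qfact A m / (qfact A (m - l) * qfact A l)) *
      (qfact A n / (qfact A (n - l) * qfact A l)) *
      (qfact A (m + n + 1) / (qfact A (m + n + 1 - l) * qfact A l)) *
      (qfact A l * qfact A l) := by
    have hl := qfact_ne_zero h l
    have h₁ := qfact_ne_zero h (m - l)
    have h₂ := qfact_ne_zero h (n - l)
    have h₃ := qfact_ne_zero h (m + n + 1 - l)
    rw [Ccoef]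
    field_simp
  have hl := qfact_mem hA hA' l
  rw [key]
  exact mul_mem (mul_mem (mul_mem (mul_mem (pow_mem (neg_mem (one_mem S)) l) (binom hm))
    (binom hn)) (binom hN)) (mul_mem hl hl)

end QuantumFactorial

theorem qint_ratFunc_X_ne_zero (k : ℕ) : qint (RatFunc.X : RatFunc ℚ) ((k : ℤ) + 1) ≠ 0 := by
  have hX : (-RatFunc.X : RatFunc ℚ) ≠ 0 := neg_ne_zero.mpr RatFunc.X_ne_zero
  intro h
  rw [qint, sub_eq_zero, zpow_neg, ← mul_eq_one_iff_eq_inv₀ (zpow_ne_zero _ hX),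
    ← mul_zpow, neg_mul_neg] at h
  have hp : (Polynomial.X * Polynomial.X : Polynomial ℚ) ^ (k + 1) = 1 := by
    apply RatFunc.algebraMap_injective ℚ
    simpa only [map_pow, map_mul, map_one, RatFunc.algebraMap_X] using mod_cast h
  simpa using congrArg (Polynomial.eval 0) hp

/-- With `A` a formal variable, `C^l_{m,n} ∈ ℚ(A)` is a Laurent polynomial in `A`
with integer coefficients, i.e. lies in `ℤ[A, A⁻¹] ⊂ ℚ(A)`. -/
theorem stmt2 (m n l : ℕ) (hl : l ≤ min m n) :
    Ccoef (RatFunc.X : RatFunc ℚ) l m n ∈ LaurentZ :=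
  Ccoef_mem (Subring.subset_closure (by simp)) (Subring.subset_closure (by simp))
    RatFunc.X_ne_zero qint_ratFunc_X_ne_zero (hl.trans (min_le_left m n))
    (hl.trans (min_le_right m n))
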